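/- For every λ > 0, the sharp Sinkhorn distance S_λ : Δ_n × Δ_m → ℝ, S_λ(a,b) = ⟨T_λ(a,b), M⟩ where T_λ(a,b) is the unique minimizer of T ↦ ⟨T,M⟩ - h(T)/λ over Π(a,b), is infinitely differentiable (C^∞) on the interior of Δ_n × Δ_m. -/

import Mathlib

open scoped BigOperators

noncomputable section

/-- The transportation polytope `Π(a,b)`: `n × m` matrices with nonnegative entries,
row sums `a` and column sums `b`. -/
def transportPolytope {n m : ℕ} (a : Fin n → ℝ) (b : Fin m → ℝ) :
    Set (Matrix (Fin n) (Fin m) ℝ) :=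
  {T | (∀ i j, 0 ≤ T i j) ∧ (∀ i, ∑ j, T i j = a i) ∧ (∀ j, ∑ i, T i j = b j)}

/-- Frobenius inner product `⟨T, M⟩ = Tr(Tᵀ M)`. -/
def frob {n m : ℕ} (T M : Matrix (Fin n) (Fin m) ℝ) : ℝ :=
  ∑ i, ∑ j, T i j * M i j

/-- Entropy `h(T) = -∑ T_ij (log T_ij - 1)`, with the convention `0 log 0 = 0`
(automatic since `Real.log 0 = 0`). -/
def ent {n m : ℕ} (T : Matrix (Fin n) (Fin m) ℝ) : ℝ :=
  -∑ i, ∑ j, T i j * (Real.log (T i j) - 1)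


/-- The interior of `Δ_n × Δ_m`: pairs of strictly positive vectors summing to one. -/
def intSimplexPairs (n m : ℕ) : Set ((Fin n → ℝ) × (Fin m → ℝ)) :=
  {p | (∀ i, 0 < p.1 i) ∧ (∑ i, p.1 i = 1) ∧ (∀ j, 0 < p.2 j) ∧ (∑ j, p.2 j = 1)}

open Filter Topology InformationTheory

/-- The entropic transport objective scaled by `λ`, with `K = λ M`. -/
def entropicCost {n m : ℕ} (K T : Matrix (Fin n) (Fin m) ℝ) : ℝ :=
  ∑ i, ∑ j, (T i j * Real.log (T i j) - T i j + T i j * K i j)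

theorem entropicCost_smul {n m : ℕ} (M T : Matrix (Fin n) (Fin m) ℝ) {lam : ℝ} (hlam : 0 < lam) :
    entropicCost (lam • M) T = lam * (frob T M - ent T / lam) := by
  have h : lam * (frob T M - ent T / lam) = lam * frob T M - ent T := by
    field_simp
  rw [h]
  simp only [entropicCost, frob, ent, Finset.mul_sum, sub_neg_eq_add, ← Finset.sum_add_distrib]
  refine Finset.sum_congr rfl fun i _ => Finset.sum_congr rfl fun j _ => ?_
  simp only [Matrix.smul_apply, smul_eq_mul]
  ring

/-- The Gibbs matrix with dual potentials `w`. -/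
def gibbs {n m : ℕ} (K : Matrix (Fin n) (Fin m) ℝ) (w : (Fin n → ℝ) × (Fin m → ℝ)) :
    Matrix (Fin n) (Fin m) ℝ :=
  fun i j => Real.exp (w.1 i + w.2 j - K i j)

theorem gibbs_pos {n m : ℕ} (K : Matrix (Fin n) (Fin m) ℝ) (w : (Fin n → ℝ) × (Fin m → ℝ))
    (i : Fin n) (j : Fin m) : 0 < gibbs K w i j :=
  Real.exp_pos _

theorem mul_klFun_div (x : ℝ) {y : ℝ} (hy : 0 < y) :
    y * klFun (x / y) = x * Real.log x - x + y - x * Real.log y := by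
  rcases eq_or_ne x 0 with rfl | hx
  · simp [klFun]
  · rw [klFun, Real.log_div hx hy.ne']
    field_simp
    ring

theorem entropicCost_eq_of_mem {n m : ℕ} (K : Matrix (Fin n) (Fin m) ℝ)
    (w : (Fin n → ℝ) × (Fin m → ℝ)) {a : Fin n → ℝ} {b : Fin m → ℝ}
    {T : Matrix (Fin n) (Fin m) ℝ} (hT : T ∈ transportPolytope a b) :
    entropicCost K T = ∑ i, ∑ j, gibbs K w i j * klFun (T i j / gibbs K w i j)
      - ∑ i, ∑ j, gibbs K w i j + (∑ i, w.1 i * a i + ∑ j, w.2 j * b j) := by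
  obtain ⟨-, hr, hc⟩ := hT
  have h1 : ∑ i, w.1 i * a i = ∑ i, ∑ j, w.1 i * T i j :=
    Finset.sum_congr rfl fun i _ => by rw [← hr i, Finset.mul_sum]
  have h2 : ∑ j, w.2 j * b j = ∑ i, ∑ j, w.2 j * T i j := by
    rw [Finset.sum_comm]
    exact Finset.sum_congr rfl fun j _ => by rw [← hc j, Finset.mul_sum]
  rw [h1, h2]
  simp only [entropicCost, ← Finset.sum_add_distrib, ← Finset.sum_sub_distrib]
  refine Finset.sum_congr rfl fun i _ => Finset.sum_congr rfl fun j _ => ?_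
  rw [mul_klFun_div _ (gibbs_pos K w i j), gibbs, Real.log_exp]
  ring

/-- A Gibbs matrix in the transportation polytope is the only minimizer of the entropic cost. -/
theorem eq_gibbs_of_isMinOn {n m : ℕ} {K : Matrix (Fin n) (Fin m) ℝ}
    {w : (Fin n → ℝ) × (Fin m → ℝ)} {a : Fin n → ℝ} {b : Fin m → ℝ}
    {T : Matrix (Fin n) (Fin m) ℝ} (hT : T ∈ transportPolytope a b)
    (hmin : IsMinOn (entropicCost K) (transportPolytope a b) T)
    (hw : gibbs K w ∈ transportPolytope a b) : T = gibbs K w := by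
  have hle : entropicCost K T ≤ entropicCost K (gibbs K w) := hmin hw
  have hself : ∑ i, ∑ j, gibbs K w i j * klFun (gibbs K w i j / gibbs K w i j) = 0 :=
    Finset.sum_eq_zero fun i _ => Finset.sum_eq_zero fun j _ => by
      rw [div_self (gibbs_pos K w i j).ne', klFun_one, mul_zero]
  rw [entropicCost_eq_of_mem K w hT, entropicCost_eq_of_mem K w hw, hself] at hle
  have hnn : ∀ i j, 0 ≤ gibbs K w i j * klFun (T i j / gibbs K w i j) := fun i j =>
    mul_nonneg (gibbs_pos K w i j).le
      (klFun_nonneg (div_nonneg (hT.1 i j) (gibbs_pos K w i j).le))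
  have hsum : ∑ i, ∑ j, gibbs K w i j * klFun (T i j / gibbs K w i j) = 0 :=
    le_antisymm (by linarith) (Finset.sum_nonneg fun i _ => Finset.sum_nonneg fun j _ => hnn i j)
  ext i j
  have hi := (Finset.sum_eq_zero_iff_of_nonneg
    fun i _ => Finset.sum_nonneg fun j _ => hnn i j).1 hsum i (Finset.mem_univ i)
  have hij := (Finset.sum_eq_zero_iff_of_nonneg fun j _ => hnn i j).1 hi j (Finset.mem_univ j)
  have hkl := (mul_eq_zero.1 hij).resolve_left (gibbs_pos K w i j).ne'
  rw [klFun_eq_zero_iff (div_nonneg (hT.1 i j) (gibbs_pos K w i j).le)] at hkl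
  exact (div_eq_one_iff_eq (gibbs_pos K w i j).ne').1 hkl

/-- Minimizers of the entropic cost have positive entries. -/
theorem pos_of_isMinOn_entropicCost {n m : ℕ} {K : Matrix (Fin n) (Fin m) ℝ}
    {p : (Fin n → ℝ) × (Fin m → ℝ)} (hp : p ∈ intSimplexPairs n m)
    {T : Matrix (Fin n) (Fin m) ℝ} (hT : T ∈ transportPolytope p.1 p.2)
    (hmin : IsMinOn (entropicCost K) (transportPolytope p.1 p.2) T) (i : Fin n) (j : Fin m) :
    0 < T i j := by
  obtain ⟨ha, ha1, hb, hb1⟩ := hp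
  obtain ⟨hT0, hr, hc⟩ := hT
  refine (hT0 i j).lt_of_ne' fun hij => ?_
  set P : Matrix (Fin n) (Fin m) ℝ := fun i j => p.1 i * p.2 j with hP
  have hPpos : ∀ k l, 0 < P k l := fun k l => mul_pos (ha k) (hb l)
  set D := entropicCost K P - entropicCost K T with hD
  set c := (|D| + 1) / P i j with hc'
  have hcpos : 0 < c := div_pos (by positivity) (hPpos i j)
  set t := Real.exp (-c) with ht
  have ht0 : 0 < t := Real.exp_pos _
  have ht1 : t < 1 := by simpa [ht] using hcpos
  have hmem : (fun k l => (1 - t) * T k l + t * P k l : Matrix (Fin n) (Fin m) ℝ) ∈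
      transportPolytope p.1 p.2 := by
    refine ⟨fun k l => ?_, fun k => ?_, fun l => ?_⟩
    · exact add_nonneg (mul_nonneg (by linarith) (hT0 k l)) (mul_nonneg ht0.le (hPpos k l).le)
    · simp only [hP, Finset.sum_add_distrib, ← Finset.mul_sum, hr, hb1]
      ring
    · simp only [hP, Finset.sum_add_distrib, ← Finset.mul_sum, ← Finset.sum_mul, hc, ha1]
      ring
  have hle : entropicCost K T ≤ _ := hmin hmem
  have hbound : entropicCost K (fun k l => (1 - t) * T k l + t * P k l) ≤
      (1 - t) * entropicCost K T + t * entropicCost K P + t * (P i j * -c) := by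
    have hsingle : t * (P i j * -c) =
        ∑ k, ∑ l, if k = i then (if l = j then t * (P k l * -c) else 0) else 0 := by
      simp
    rw [hsingle]
    simp only [entropicCost, Finset.mul_sum, ← Finset.sum_add_distrib]
    refine Finset.sum_le_sum fun k _ => Finset.sum_le_sum fun l _ => ?_
    by_cases hkl : k = i ∧ l = j
    · obtain ⟨rfl, rfl⟩ := hkl
      simp only [hij, if_true, mul_zero, zero_add]
      rw [Real.log_mul ht0.ne' (hPpos k l).ne', ht, Real.log_exp]
      apply le_of_eq
      ring
    · have hite : (if k = i then (if l = j then t * (P k l * -c) else 0) else 0) = 0 := by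
        rw [← ite_and, if_neg hkl]
      have hconv := Real.convexOn_mul_log.2 (Set.mem_Ici.2 (hT0 k l))
        (Set.mem_Ici.2 (hPpos k l).le) (sub_nonneg.2 ht1.le) ht0.le (sub_add_cancel 1 t)
      simp only [smul_eq_mul] at hconv
      rw [hite]
      linarith
  have hPc : P i j * -c = -(|D| + 1) := by
    rw [hc']
    field_simp [(hPpos i j).ne']
  rw [hPc] at hbound
  have : t * (D - (|D| + 1)) < 0 :=
    mul_neg_of_pos_of_neg ht0 (by linarith [le_abs_self D])
  have hge : 0 ≤ t * (D - (|D| + 1)) := by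
    rw [hD]
    rw [hD] at hbound
    linarith
  linarith

/-- Stationarity of the entropic cost in the rank-one directions tangent to the polytope. -/
theorem sum_log_add_mul_eq_zero {n m : ℕ} {K : Matrix (Fin n) (Fin m) ℝ}
    {a : Fin n → ℝ} {b : Fin m → ℝ} {T : Matrix (Fin n) (Fin m) ℝ}
    (hT : T ∈ transportPolytope a b)
    (hmin : IsMinOn (entropicCost K) (transportPolytope a b) T) (hpos : ∀ i j, 0 < T i j)
    {α : Fin n → ℝ} {β : Fin m → ℝ} (hα : ∑ i, α i = 0) (hβ : ∑ j, β j = 0) :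
    ∑ i, ∑ j, (Real.log (T i j) + K i j) * (α i * β j) = 0 := by
  have hline : ∀ i j, HasDerivAt (fun t : ℝ => T i j + t * (α i * β j)) (α i * β j) 0 :=
    fun i j => by simpa using ((hasDerivAt_id (0 : ℝ)).mul_const (α i * β j)).const_add (T i j)
  have hder : HasDerivAt
      (fun t : ℝ => entropicCost K (fun i j => T i j + t * (α i * β j)))
      (∑ i, ∑ j, (Real.log (T i j) + K i j) * (α i * β j)) 0 := by
    unfold entropicCost
    refine HasDerivAt.fun_sum fun i _ => HasDerivAt.fun_sum fun j _ => ?_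
    have hlog := (Real.hasDerivAt_mul_log
      (x := T i j + 0 * (α i * β j)) (by simpa using (hpos i j).ne')).comp 0 (hline i j)
    have := (hlog.sub (hline i j)).add ((hline i j).mul_const (K i j))
    convert! this using 1
    simp only [zero_mul, add_zero]
    ring
  refine IsLocalMin.hasDerivAt_eq_zero ?_ hder
  have hev : ∀ᶠ t in 𝓝 (0 : ℝ), ∀ i j, 0 < T i j + t * (α i * β j) :=
    eventually_all.2 fun i => eventually_all.2 fun j =>
      (hline i j).continuousAt.eventually_const_lt (by simpa using hpos i j)
  filter_upwards [hev] with t ht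
  have hmem : (fun i j => T i j + t * (α i * β j) : Matrix (Fin n) (Fin m) ℝ) ∈
      transportPolytope a b := by
    refine ⟨fun i j => (ht i j).le, fun i => ?_, fun j => ?_⟩
    · simp [Finset.sum_add_distrib, ← Finset.mul_sum, hβ, hT.2.1 i]
    · simp [Finset.sum_add_distrib, ← Finset.mul_sum, ← Finset.sum_mul, hα, hT.2.2 j]
  simpa only [zero_mul, add_zero] using show entropicCost K T ≤ _ from hmin hmem

/-- Minimizers of the entropic cost are Gibbs matrices. -/
theorem exists_eq_gibbs_of_isMinOn {n m : ℕ} (hn : 1 ≤ n) (hm : 1 ≤ m)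
    {K : Matrix (Fin n) (Fin m) ℝ}
    {p : (Fin n → ℝ) × (Fin m → ℝ)} (hp : p ∈ intSimplexPairs n m)
    {T : Matrix (Fin n) (Fin m) ℝ} (hT : T ∈ transportPolytope p.1 p.2)
    (hmin : IsMinOn (entropicCost K) (transportPolytope p.1 p.2) T) :
    ∃ w : (Fin n → ℝ) × (Fin m → ℝ), ∑ i, w.1 i - ∑ j, w.2 j = 0 ∧ T = gibbs K w := by
  have hpos := pos_of_isMinOn_entropicCost hp hT hmin
  let i₀ : Fin n := ⟨0, hn⟩
  let j₀ : Fin m := ⟨0, hm⟩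
  set G : Fin n → Fin m → ℝ := fun i j => Real.log (T i j) + K i j with hG
  have hGeq : ∀ i j, G i j = G i j₀ + (G i₀ j - G i₀ j₀) := by
    intro i j
    have h := sum_log_add_mul_eq_zero hT hmin hpos
      (α := Pi.single i 1 - Pi.single i₀ 1) (β := Pi.single j 1 - Pi.single j₀ 1)
      (by simp) (by simp)
    change ∑ k, ∑ l, G k l * _ = 0 at h
    simp only [Pi.sub_apply, Pi.single_apply, mul_sub, sub_mul, Finset.sum_sub_distrib] at h
    simp at h
    linarith
  set u : Fin n → ℝ := fun i => G i j₀
  set v : Fin m → ℝ := fun j => G i₀ j - G i₀ j₀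
  set c : ℝ := (∑ j, v j - ∑ i, u i) / (n + m) with hc
  have hnm : (n + m : ℝ) ≠ 0 := by positivity
  refine ⟨(fun i => u i + c, fun j => v j - c), ?_, ?_⟩
  · simp only [Finset.sum_add_distrib, Finset.sum_sub_distrib, Finset.sum_const,
      Finset.card_univ, Fintype.card_fin, nsmul_eq_mul]
    rw [hc]
    field_simp
    ring
  · ext i j
    have h : u i + c + (v j - c) - K i j = Real.log (T i j) := by
      have := hGeq i j
      simp only [hG] at this
      simp only [u, v, hG]
      linarith
    rw [gibbs, h, Real.exp_log (hpos i j)]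

/-- The marginals of the Gibbs matrix, corrected by a linear term that makes the map a local
diffeomorphism. -/
def gibbsMarginals {n m : ℕ} (K : Matrix (Fin n) (Fin m) ℝ) (w : (Fin n → ℝ) × (Fin m → ℝ)) :
    (Fin n → ℝ) × (Fin m → ℝ) :=
  (fun i => ∑ j, gibbs K w i j + (∑ k, w.1 k - ∑ l, w.2 l),
    fun j => ∑ i, gibbs K w i j - (∑ k, w.1 k - ∑ l, w.2 l))

theorem contDiff_gibbs_apply {n m : ℕ} (K : Matrix (Fin n) (Fin m) ℝ) (i : Fin n) (j : Fin m)
    {r : WithTop ℕ∞} : ContDiff ℝ r fun w => gibbs K w i j := by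
  unfold gibbs
  fun_prop

theorem contDiff_gibbsMarginals {n m : ℕ} (K : Matrix (Fin n) (Fin m) ℝ) {r : WithTop ℕ∞} :
    ContDiff ℝ r (gibbsMarginals K) := by
  unfold gibbsMarginals gibbs
  fun_prop

theorem hasLineDerivAt_gibbsMarginals {n m : ℕ} (K : Matrix (Fin n) (Fin m) ℝ)
    (w d : (Fin n → ℝ) × (Fin m → ℝ)) :
    HasLineDerivAt ℝ (gibbsMarginals K)
      (fun i => ∑ j, gibbs K w i j * (d.1 i + d.2 j) + (∑ k, d.1 k - ∑ l, d.2 l),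
        fun j => ∑ i, gibbs K w i j * (d.1 i + d.2 j) - (∑ k, d.1 k - ∑ l, d.2 l)) w d := by
  have hline : ∀ x y : ℝ, HasDerivAt (fun t : ℝ => x + t * y) y 0 := fun x y => by
    simpa using ((hasDerivAt_id (0 : ℝ)).mul_const y).const_add x
  have hs : HasDerivAt
      (fun t : ℝ => ∑ k, (w + t • d).1 k - ∑ l, (w + t • d).2 l)
      (∑ k, d.1 k - ∑ l, d.2 l) 0 :=
    (HasDerivAt.fun_sum fun k _ => hline (w.1 k) (d.1 k)).sub
      (HasDerivAt.fun_sum fun l _ => hline (w.2 l) (d.2 l))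
  have hg : ∀ i j, HasDerivAt (fun t : ℝ => gibbs K (w + t • d) i j)
      (gibbs K w i j * (d.1 i + d.2 j)) 0 := fun i j => by
    have := (((hline (w.1 i) (d.1 i)).add (hline (w.2 j) (d.2 j))).sub_const (K i j)).exp
    simpa [gibbs] using this
  exact (hasDerivAt_pi.2 fun i => (HasDerivAt.fun_sum fun j _ => hg i j).add hs).prodMk
    (hasDerivAt_pi.2 fun j => (HasDerivAt.fun_sum fun i _ => hg i j).sub hs)

theorem injective_fderiv_gibbsMarginals {n m : ℕ} (hn : 1 ≤ n) (hm : 1 ≤ m)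
    (K : Matrix (Fin n) (Fin m) ℝ) (w : (Fin n → ℝ) × (Fin m → ℝ)) :
    Function.Injective (fderiv ℝ (gibbsMarginals K) w) := by
  rw [injective_iff_map_eq_zero]
  intro d hd
  have hdiff : DifferentiableAt ℝ (gibbsMarginals K) w :=
    (contDiff_gibbsMarginals K (r := 1)).differentiable one_ne_zero w
  have heq := (hasLineDerivAt_gibbsMarginals K w d).unique (hdiff.hasFDerivAt.hasLineDerivAt d)
  rw [hd, Prod.mk_eq_zero] at heq
  set s := ∑ k, d.1 k - ∑ l, d.2 l with hs
  have hrow : ∀ i, ∑ j, gibbs K w i j * (d.1 i + d.2 j) + s = 0 := fun i => congrFun heq.1 i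
  have hcol : ∀ j, ∑ i, gibbs K w i j * (d.1 i + d.2 j) - s = 0 := fun j => congrFun heq.2 j
  have hquad : ∑ i, ∑ j, gibbs K w i j * (d.1 i + d.2 j) ^ 2 + s ^ 2 = 0 := by
    have hsplit : ∑ i, ∑ j, gibbs K w i j * (d.1 i + d.2 j) ^ 2 =
        ∑ i, d.1 i * ∑ j, gibbs K w i j * (d.1 i + d.2 j) +
          ∑ j, d.2 j * ∑ i, gibbs K w i j * (d.1 i + d.2 j) := by
      simp only [Finset.mul_sum]
      rw [Finset.sum_comm (s := (Finset.univ : Finset (Fin m)))]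
      simp only [← Finset.sum_add_distrib]
      exact Finset.sum_congr rfl fun i _ => Finset.sum_congr rfl fun j _ => by ring
    simp only [hsplit, fun i => eq_neg_of_add_eq_zero_left (hrow i),
      fun j => sub_eq_zero.1 (hcol j), ← Finset.sum_mul]
    rw [hs]
    ring
  have hnn : ∀ i j, 0 ≤ gibbs K w i j * (d.1 i + d.2 j) ^ 2 := fun i j =>
    mul_nonneg (gibbs_pos K w i j).le (sq_nonneg _)
  have hnn' : 0 ≤ ∑ i, ∑ j, gibbs K w i j * (d.1 i + d.2 j) ^ 2 :=
    Finset.sum_nonneg fun i _ => Finset.sum_nonneg fun j _ => hnn i j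
  have hs0 : s = 0 := pow_eq_zero_iff two_ne_zero |>.1 (by linarith [sq_nonneg s])
  have hadd : ∀ i j, d.1 i + d.2 j = 0 := by
    intro i j
    have hsum : ∑ i, ∑ j, gibbs K w i j * (d.1 i + d.2 j) ^ 2 = 0 := by linarith [sq_nonneg s]
    have hi := (Finset.sum_eq_zero_iff_of_nonneg
      fun i _ => Finset.sum_nonneg fun j _ => hnn i j).1 hsum i (Finset.mem_univ i)
    have hij := (Finset.sum_eq_zero_iff_of_nonneg fun j _ => hnn i j).1 hi j (Finset.mem_univ j)
    simpa [(gibbs_pos K w i j).ne'] using hij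
  let i₀ : Fin n := ⟨0, hn⟩
  let j₀ : Fin m := ⟨0, hm⟩
  have h1 : ∀ i, d.1 i = -d.2 j₀ := fun i => by linarith [hadd i j₀]
  have h2 : ∀ j, d.2 j = d.2 j₀ := fun j => by linarith [hadd i₀ j, hadd i₀ j₀]
  have hz : d.2 j₀ = 0 := by
    have h : s = -((n + m : ℝ) * d.2 j₀) := by
      rw [hs, Finset.sum_congr rfl fun i _ => h1 i, Finset.sum_congr rfl fun j _ => h2 j]
      simp
      ring
    have hnm : (n + m : ℝ) ≠ 0 := by positivity
    rw [hs0] at h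
    exact (mul_eq_zero.1 (neg_eq_zero.1 h.symm)).resolve_left hnm
  ext k
  · simp [h1 k, hz]
  · simp [h2 k, hz]

theorem gibbs_mem_transportPolytope {n m : ℕ} (hn : 1 ≤ n) {K : Matrix (Fin n) (Fin m) ℝ}
    {w p : (Fin n → ℝ) × (Fin m → ℝ)} (hp : p ∈ intSimplexPairs n m)
    (hw : gibbsMarginals K w = p) : gibbs K w ∈ transportPolytope p.1 p.2 := by
  obtain ⟨-, ha1, -, hb1⟩ := hp
  set s := ∑ k, w.1 k - ∑ l, w.2 l with hs
  have hrow : ∀ i, ∑ j, gibbs K w i j + s = p.1 i := fun i => congrFun (congrArg Prod.fst hw) i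
  have hcol : ∀ j, ∑ i, gibbs K w i j - s = p.2 j := fun j => congrFun (congrArg Prod.snd hw) j
  have hs0 : s = 0 := by
    simp only [← hrow, Finset.sum_add_distrib] at ha1
    simp only [← hcol, Finset.sum_sub_distrib] at hb1
    rw [Finset.sum_comm] at hb1
    simp only [Finset.sum_const, Finset.card_univ, Fintype.card_fin, nsmul_eq_mul] at ha1 hb1
    have h : (n + m : ℝ) * s = 0 := by linarith
    have hnm : (n + m : ℝ) ≠ 0 := by positivity
    exact (mul_eq_zero.1 h).resolve_left hnm
  simp only [hs0, add_zero, sub_zero] at hrow hcol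
  exact ⟨fun i j => (gibbs_pos K w i j).le, hrow, hcol⟩

/-- for every `λ > 0`, the sharp Sinkhorn distance
`S_λ(a,b) = ⟨T_λ(a,b), M⟩`, where `T_λ(a,b)` is the unique minimizer of
`T ↦ ⟨T,M⟩ - h(T)/λ` over `Π(a,b)` (given here by a selection `Tsel`), is `C^∞` on the
interior of `Δ_n × Δ_m` (smoothness along the affine subspace, via `ContDiffOn`). -/
theorem statement6 {n m : ℕ} (hn : 1 ≤ n) (hm : 1 ≤ m)
    (M : Matrix (Fin n) (Fin m) ℝ) (lam : ℝ) (hlam : 0 < lam)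
    (Tsel : (Fin n → ℝ) → (Fin m → ℝ) → Matrix (Fin n) (Fin m) ℝ)
    (hTsel : ∀ p ∈ intSimplexPairs n m,
      Tsel p.1 p.2 ∈ transportPolytope p.1 p.2 ∧
      IsMinOn (fun T => frob T M - ent T / lam) (transportPolytope p.1 p.2) (Tsel p.1 p.2)) :
    ContDiffOn ℝ (⊤ : ℕ∞)
      (fun p : (Fin n → ℝ) × (Fin m → ℝ) => frob (Tsel p.1 p.2) M)
      (intSimplexPairs n m) := by
  set K := lam • M with hK
  have hmin : ∀ p ∈ intSimplexPairs n m,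
      IsMinOn (entropicCost K) (transportPolytope p.1 p.2) (Tsel p.1 p.2) := by
    intro p hp S hS
    have h := (hTsel p hp).2 hS
    simp only [Set.mem_ofPred_eq] at h ⊢
    rw [hK, entropicCost_smul M _ hlam, entropicCost_smul M _ hlam]
    exact mul_le_mul_of_nonneg_left h hlam.le
  intro p₀ hp₀
  obtain ⟨w₀, hw₀, hTw₀⟩ := exists_eq_gibbs_of_isMinOn hn hm hp₀ (hTsel p₀ hp₀).1 (hmin p₀ hp₀)
  have hmarg : gibbsMarginals K w₀ = p₀ := by
    obtain ⟨-, hr, hc⟩ := (hTsel p₀ hp₀).1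
    rw [hTw₀] at hr hc
    ext k <;> simp [gibbsMarginals, hw₀, hr, hc]
  have hsmooth : ContDiffAt ℝ (⊤ : ℕ∞) (gibbsMarginals K) w₀ :=
    (contDiff_gibbsMarginals K).contDiffAt
  let e := (LinearEquiv.ofInjectiveEndo (fderiv ℝ (gibbsMarginals K) w₀ :
    ((Fin n → ℝ) × (Fin m → ℝ)) →ₗ[ℝ] _)
    (injective_fderiv_gibbsMarginals hn hm K w₀)).toContinuousLinearEquiv
  have htop : ((⊤ : ℕ∞) : WithTop ℕ∞) ≠ 0 := by simp
  have hfd : HasFDerivAt (gibbsMarginals K)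
      (e : ((Fin n → ℝ) × (Fin m → ℝ)) →L[ℝ] _) w₀ :=
    (hsmooth.differentiableAt htop).hasFDerivAt
  have hinv := hsmooth.to_localInverse hfd htop
  have hright := (hsmooth.hasStrictFDerivAt' hfd htop).eventually_right_inverse
  rw [hmarg] at hinv hright
  have hcomp : ContDiffAt ℝ (⊤ : ℕ∞)
      (fun p => frob (gibbs K (hsmooth.localInverse hfd htop p)) M) p₀ := by
    unfold frob
    exact ContDiffAt.sum fun i _ => ContDiffAt.sum fun j _ =>
      ((contDiff_gibbs_apply K i j).contDiffAt.comp p₀ hinv).mul contDiffAt_const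
  have heq : ∀ p ∈ intSimplexPairs n m,
      gibbsMarginals K (hsmooth.localInverse hfd htop p) = p →
      frob (Tsel p.1 p.2) M = frob (gibbs K (hsmooth.localInverse hfd htop p)) M :=
    fun p hp h => by
      rw [eq_gibbs_of_isMinOn (hTsel p hp).1 (hmin p hp) (gibbs_mem_transportPolytope hn hp h)]
  refine hcomp.contDiffWithinAt.congr_of_eventuallyEq ?_ (heq p₀ hp₀ hright.self_of_nhds)
  filter_upwards [self_mem_nhdsWithin, nhdsWithin_le_nhds hright] with p hp h
  exact heq p hp h
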